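/- arXiv:1211.3891 — 3 statements merged into one kernel-verified Lean document; each statement's English description precedes it below -/
import Mathlib

section
/- Uniform positivity of truncated weighted sums of translates (Proposition 4.7): Let d ≥ 1, let u : ℤ^d → ℝ satisfy |u(k)| ≤ C e^{−α|k|₁} for all k ∈ ℤ^d with constants C, α > 0, let I₀ ∈ ℕ₀^d, and let c_u ≠ 0 be such that ∑_{k∈ℤ^d} k^{I₀} u(x−k) = c_u for every x ∈ ℤ^d. For l ∈ ℕ set R_l = max{ 2l + (2/α) ln( 2·3^d C / (|c_u| (1 − e^{−α/2})) ), 8(d+|I₀|)²/α² }. Then for every x ∈ Λ_l one has (2/c_u) ∑_{k ∈ Λ_{R_l}} k^{I₀} u(x−k) ≥ 1. -/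
noncomputable section

/-- The `ℓ¹` distance on `ℤ^d`. -/
def dist1 {d : ℕ} (x y : Fin d → ℤ) : ℕ := ∑ i, (x i - y i).natAbs

/-- The cube `Λ_{L,k} = {x ∈ ℤ^d : |x-k|_∞ ≤ L}` as a finite set. -/
def cube {d : ℕ} (L : ℕ) (k : Fin d → ℤ) : Finset (Fin d → ℤ) :=
  Fintype.piFinset fun i => Finset.Icc (k i - L) (k i + L)

/-- The cube `Λ_R = {k ∈ ℤ^d : |k|_∞ ≤ R}` with a real radius `R`. -/
def cubeR {d : ℕ} (R : ℝ) : Finset (Fin d → ℤ) :=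
  Fintype.piFinset fun _ => Finset.Icc ⌈-R⌉ ⌊R⌋

/-- The `ℓ^∞` norm of an integer vector, as a natural number. -/
def supNatAbs {d : ℕ} (k : Fin d → ℤ) : ℕ := Finset.univ.sup fun i => (k i).natAbs

lemma natAbs_le_supNatAbs {d : ℕ} (k : Fin d → ℤ) (i : Fin d) : (k i).natAbs ≤ supNatAbs k :=
  Finset.le_sup (f := fun i => (k i).natAbs) (Finset.mem_univ i)

lemma abs_le_supNatAbs {d : ℕ} (k : Fin d → ℤ) (i : Fin d) : |(k i : ℝ)| ≤ supNatAbs k := by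
  rw [← Int.cast_abs, Int.abs_eq_natAbs, Int.cast_natCast]
  exact_mod_cast natAbs_le_supNatAbs k i

lemma lt_supNatAbs_of_notMem_cubeR {d : ℕ} {R : ℝ} {k : Fin d → ℤ} (hk : k ∉ cubeR R) :
    R < supNatAbs k := by
  contrapose! hk
  refine Fintype.mem_piFinset.2 fun i => Finset.mem_Icc.2 ?_
  have h := abs_le.1 ((abs_le_supNatAbs k i).trans hk)
  exact ⟨Int.ceil_le.2 h.1, Int.le_floor.2 h.2⟩

lemma card_filter_supNatAbs_le {d n : ℕ} (hn : 1 ≤ n) (s : Finset (Fin d → ℤ)) :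
    ((s.filter fun k => supNatAbs k = n).card : ℝ) ≤ 3 ^ d * (n : ℝ) ^ d := by
  have hsub : (s.filter fun k => supNatAbs k = n) ⊆ cube n (0 : Fin d → ℤ) := by
    intro k hk
    have hk' := (Finset.mem_filter.1 hk).2
    refine Fintype.mem_piFinset.2 fun i => Finset.mem_Icc.2 ?_
    have := natAbs_le_supNatAbs k i
    simp only [Pi.zero_apply]
    omega
  have hcard : (cube n (0 : Fin d → ℤ)).card = (2 * n + 1) ^ d := by
    simp only [cube, Fintype.card_piFinset, Pi.zero_apply, Int.card_Icc, Finset.prod_const,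
      Finset.card_univ, Fintype.card_fin]
    congr 1
    omega
  have h : (s.filter fun k => supNatAbs k = n).card ≤ (3 * n) ^ d :=
    (Finset.card_le_card hsub).trans (hcard ▸ Nat.pow_le_pow_left (by omega) d)
  rw [← mul_pow]
  exact_mod_cast h

lemma supNatAbs_le_dist1_add {d l : ℕ} {x : Fin d → ℤ}
    (hx : x ∈ cube l (0 : Fin d → ℤ)) (k : Fin d → ℤ) :
    supNatAbs k ≤ dist1 (x - k) 0 + l := by
  refine Finset.sup_le fun i _ => ?_
  have h1 : (x i - k i).natAbs ≤ dist1 (x - k) 0 := by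
    have := Finset.single_le_sum (f := fun i => ((x - k) i - (0 : Fin d → ℤ) i).natAbs)
      (fun _ _ => Nat.zero_le _) (Finset.mem_univ i)
    simpa [dist1] using this
  have h2 := Finset.mem_Icc.1 (Fintype.mem_piFinset.1 hx i)
  simp only [Pi.zero_apply] at h2
  omega

lemma abs_prod_pow_le {d : ℕ} (I₀ : Fin d → ℕ) (k : Fin d → ℤ) :
    |∏ r, (k r : ℝ) ^ I₀ r| ≤ (supNatAbs k : ℝ) ^ ∑ r, I₀ r := by
  rw [Finset.abs_prod, ← Finset.prod_pow_eq_pow_sum]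
  refine Finset.prod_le_prod (fun _ _ => abs_nonneg _) fun i _ => ?_
  rw [abs_pow]
  exact pow_le_pow_left₀ (abs_nonneg _) (abs_le_supNatAbs k i) _

/-- Polynomial growth is dominated by `exp (α n / 2)` beyond `8 N² / α²`. -/
lemma pow_le_exp_of_le {α : ℝ} (hα : 0 < α) {t : ℝ} (N : ℕ) (ht : 0 ≤ t)
    (h : 8 * (N : ℝ) ^ 2 / α ^ 2 ≤ t) : t ^ N ≤ Real.exp (α * t / 2) := by
  have hsq : √(2 * t) ^ 2 = 2 * t := Real.sq_sqrt (by positivity)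
  have h1 : t ≤ Real.exp √(2 * t) := by
    have := Real.quadratic_le_exp_of_nonneg (Real.sqrt_nonneg (2 * t))
    linarith [Real.sqrt_nonneg (2 * t)]
  have h2 : N * √(2 * t) ≤ α * t / 2 := by
    refine abs_le_of_sq_le_sq' ?_ (by positivity) |>.2
    rw [div_le_iff₀ (by positivity)] at h
    rw [mul_pow, hsq]
    nlinarith
  calc t ^ N ≤ Real.exp √(2 * t) ^ N := pow_le_pow_left₀ ht h1 N
    _ = Real.exp (N * √(2 * t)) := (Real.exp_nat_mul _ _).symm
    _ ≤ _ := Real.exp_le_exp.2 h2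

lemma sum_pow_le_of_forall_le {q : ℝ} (hq : 0 ≤ q) (hq1 : q < 1) (A : Finset ℕ) (m : ℕ)
    (hA : ∀ n ∈ A, m ≤ n) : ∑ n ∈ A, q ^ n ≤ q ^ m / (1 - q) := by
  refine le_trans ?_ (geom_sum_Ico_le_of_lt_one (n := A.sup id + 1) hq hq1)
  refine Finset.sum_le_sum_of_subset_of_nonneg (fun n hn => Finset.mem_Ico.2 ⟨hA n hn, ?_⟩)
    fun _ _ _ => pow_nonneg hq _
  exact Nat.lt_succ_of_le (Finset.le_sup (f := id) hn)

/-- Bound for finite sums of weighted translates supported outside `Λ_R`. -/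
lemma sum_abs_weighted_translate_le {d : ℕ} {u : (Fin d → ℤ) → ℝ}
    {C α : ℝ} (hC : 0 < C) (hα : 0 < α)
    (hu : ∀ k : Fin d → ℤ, |u k| ≤ C * Real.exp (-(α * (dist1 k 0 : ℝ))))
    (I₀ : Fin d → ℕ) {l : ℕ} {R : ℝ}
    (hR : 8 * ((d : ℝ) + ∑ r, (I₀ r : ℝ)) ^ 2 / α ^ 2 ≤ R)
    {x : Fin d → ℤ} (hx : x ∈ cube l (0 : Fin d → ℤ))
    (s : Finset (Fin d → ℤ)) (hs : ∀ k ∈ s, k ∉ cubeR R) :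
    ∑ k ∈ s, |(∏ r, (k r : ℝ) ^ I₀ r) * u (x - k)| ≤
      3 ^ d * C * Real.exp (α * l) * (Real.exp (-(α * R / 2)) / (1 - Real.exp (-(α / 2)))) := by
  set q := Real.exp (-(α / 2)) with hq
  have hq0 : 0 < q := Real.exp_pos _
  have hq1 : q < 1 := Real.exp_lt_one_iff.2 (by linarith)
  set D := ∑ r, I₀ r with hD
  have hR0 : 0 ≤ R := le_trans (by positivity) hR
  have hqn (n : ℕ) : q ^ n = Real.exp (-(α * n / 2)) := by
    rw [hq, ← Real.exp_nat_mul]; congr 1; ring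
  set g : ℕ → ℝ := fun n => (n : ℝ) ^ D * (C * Real.exp (α * l - α * n)) with hg
  have hterm (k : Fin d → ℤ) : |(∏ r, (k r : ℝ) ^ I₀ r) * u (x - k)| ≤ g (supNatAbs k) := by
    rw [abs_mul]
    have h : (supNatAbs k : ℝ) ≤ dist1 (x - k) 0 + l := by
      exact_mod_cast supNatAbs_le_dist1_add hx k
    refine mul_le_mul (abs_prod_pow_le I₀ k) ((hu _).trans ?_) (abs_nonneg _) (by positivity)
    gcongr
    nlinarith
  have hlt : ∀ n ∈ s.image supNatAbs, R < n := by
    intro n hn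
    obtain ⟨k, hk, rfl⟩ := Finset.mem_image.1 hn
    exact lt_supNatAbs_of_notMem_cubeR (hs k hk)
  have hlayer : ∀ n ∈ s.image supNatAbs, ∑ k ∈ s with supNatAbs k = n, g (supNatAbs k) ≤
      3 ^ d * C * Real.exp (α * l) * q ^ n := by
    intro n hn
    have hn' := hlt n hn
    have hn1 : 1 ≤ n := by
      have : (0 : ℝ) < n := hR0.trans_lt hn'
      exact_mod_cast this
    have hpow : (n : ℝ) ^ (d + D) ≤ Real.exp (α * n / 2) := by
      refine pow_le_exp_of_le hα _ (Nat.cast_nonneg n) (le_trans (le_of_eq ?_) (hR.trans hn'.le))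
      rw [hD]; push_cast; rfl
    calc ∑ k ∈ s with supNatAbs k = n, g (supNatAbs k)
        = (s.filter fun k => supNatAbs k = n).card * g n := by
          rw [Finset.sum_congr rfl fun k hk => by rw [(Finset.mem_filter.1 hk).2],
            Finset.sum_const, nsmul_eq_mul]
      _ ≤ 3 ^ d * (n : ℝ) ^ d * g n :=
          mul_le_mul_of_nonneg_right (card_filter_supNatAbs_le hn1 s) (by positivity)
      _ = 3 ^ d * C * Real.exp (α * l - α * n) * (n : ℝ) ^ (d + D) := by
          rw [hg, pow_add]; ring
      _ ≤ 3 ^ d * C * Real.exp (α * l - α * n) * Real.exp (α * n / 2) := by gcongr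
      _ = 3 ^ d * C * Real.exp (α * l) * q ^ n := by
          rw [hqn, mul_assoc _ (Real.exp _), mul_assoc _ (Real.exp _), ← Real.exp_add,
            ← Real.exp_add]
          congr 2; ring
  calc ∑ k ∈ s, |(∏ r, (k r : ℝ) ^ I₀ r) * u (x - k)|
      ≤ ∑ k ∈ s, g (supNatAbs k) := Finset.sum_le_sum fun k _ => hterm k
    _ = ∑ n ∈ s.image supNatAbs, ∑ k ∈ s with supNatAbs k = n, g (supNatAbs k) :=
        (Finset.sum_fiberwise_of_maps_to (fun k hk => Finset.mem_image_of_mem _ hk) _).symm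
    _ ≤ ∑ n ∈ s.image supNatAbs, 3 ^ d * C * Real.exp (α * l) * q ^ n :=
        Finset.sum_le_sum hlayer
    _ = 3 ^ d * C * Real.exp (α * l) * ∑ n ∈ s.image supNatAbs, q ^ n := by
        rw [Finset.mul_sum]
    _ ≤ 3 ^ d * C * Real.exp (α * l) * (q ^ ⌈R⌉₊ / (1 - q)) := by
        refine mul_le_mul_of_nonneg_left ?_ (by positivity)
        exact sum_pow_le_of_forall_le hq0.le hq1 _ _ fun n hn => Nat.ceil_le.2 (hlt n hn).le
    _ ≤ _ := by
        have h1q : 0 < 1 - q := sub_pos.2 hq1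
        rw [hqn]
        gcongr
        exact Nat.le_ceil R

/-- **Uniform positivity of truncated weighted sums of translates** (Proposition 4.7). -/
theorem stmt_12 (d : ℕ) (hd : 1 ≤ d) (u : (Fin d → ℤ) → ℝ)
    (Cdec α : ℝ) (hCdec : 0 < Cdec) (hα : 0 < α)
    (hu_decay : ∀ k : Fin d → ℤ, |u k| ≤ Cdec * Real.exp (-(α * (dist1 k 0 : ℝ))))
    (I₀ : Fin d → ℕ) (cu : ℝ) (hcu : cu ≠ 0)
    (hsum : ∀ x : Fin d → ℤ,
      (∑' k : Fin d → ℤ, (∏ r, ((k r : ℝ)) ^ I₀ r) * u (x - k)) = cu)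
    (l : ℕ) (hl : 1 ≤ l) (R : ℝ)
    (hR : R = max
      (2 * (l : ℝ) + (2 / α) *
        Real.log (2 * 3 ^ d * Cdec / (|cu| * (1 - Real.exp (-(α / 2))))))
      (8 * ((d : ℝ) + ∑ r, (I₀ r : ℝ)) ^ 2 / α ^ 2)) :
    ∀ x ∈ cube l (0 : Fin d → ℤ),
      1 ≤ (2 / cu) * ∑ k ∈ cubeR (d := d) R, (∏ r, ((k r : ℝ)) ^ I₀ r) * u (x - k) := by
  intro x hx
  set F : (Fin d → ℤ) → ℝ := fun k => (∏ r, (k r : ℝ) ^ I₀ r) * u (x - k) with hF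
  have hFsum : HasSum F cu := by
    have hs : Summable F := by
      by_contra h
      exact hcu ((hsum x).symm.trans (tsum_eq_zero_of_not_summable h))
    exact hsum x ▸ hs.hasSum
  have hc : 0 < |cu| := abs_pos.2 hcu
  have h1q : 0 < 1 - Real.exp (-(α / 2)) := sub_pos.2 (Real.exp_lt_one_iff.2 (by linarith))
  have hRexp : 3 ^ d * Cdec * Real.exp (α * l) *
      (Real.exp (-(α * R / 2)) / (1 - Real.exp (-(α / 2)))) ≤ |cu| / 2 := by
    set A := 2 * 3 ^ d * Cdec / (|cu| * (1 - Real.exp (-(α / 2)))) with hA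
    have hA0 : 0 < A := by positivity
    have hRl : 2 * (l : ℝ) + 2 / α * Real.log A ≤ R := hR ▸ le_max_left _ _
    have hexp : Real.exp (-(α * R / 2)) ≤ Real.exp (-(α * l)) * A⁻¹ := by
      rw [← Real.exp_log (inv_pos.2 hA0), ← Real.exp_add, Real.log_inv]
      refine Real.exp_le_exp.2 ?_
      have h := mul_le_mul_of_nonneg_left hRl (half_pos hα).le
      have e : α / 2 * (2 * (l : ℝ) + 2 / α * Real.log A) = α * l + Real.log A := by
        field_simp
      linarith
    calc _ ≤ 3 ^ d * Cdec * Real.exp (α * l) *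
          (Real.exp (-(α * l)) * A⁻¹ / (1 - Real.exp (-(α / 2)))) := by gcongr
      _ = |cu| / 2 := by
        rw [Real.exp_neg (α * l), hA]
        field_simp
  have htail : |cu - ∑ k ∈ cubeR R, F k| ≤ |cu| / 2 := by
    refine le_of_tendsto ((hFsum.sub_const (∑ k ∈ cubeR R, F k)).abs) ?_
    filter_upwards [Filter.eventually_ge_atTop (cubeR (d := d) R)] with t ht
    rw [← Finset.sum_sdiff ht, add_sub_cancel_right]
    refine (Finset.abs_sum_le_sum_abs _ _).trans (le_trans ?_ hRexp)
    exact sum_abs_weighted_translate_le hCdec hα hu_decay I₀ (hR ▸ le_max_right _ _) hx _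
      fun k hk => (Finset.mem_sdiff.1 hk).2
  have hratio : |(cu - ∑ k ∈ cubeR R, F k) / cu| ≤ 1 / 2 := by
    rw [abs_div, div_le_iff₀ hc]
    linarith
  have h := (abs_le.1 hratio).2
  rw [sub_div, div_self hcu] at h
  rw [div_mul_eq_mul_div, mul_div_assoc]
  linarith

end
end

section
/- Pointwise lower bound for the exponentially averaged potential (Lemma A.2): Let d ≥ 1 and let u : ℤ^d → ℝ be finitely supported with Θ := supp u containing 0, ū := ∑_{k∈ℤ^d} u(k) > 0, and n := max_{i,j∈Θ} |i−j|₁ ≥ 1. Set c = (1/n) ln(1 + ū/(2‖u‖_{ℓ¹})), where ‖u‖_{ℓ¹} = ∑_{k} |u(k)|. For x, y ∈ ℤ^d define α^{x,y} : ℤ^d → (0,∞) by α^{x,y}(k) = (1/2)(e^{−c|k−x|₁} + e^{−c|k−y|₁}) and W^{x,y} : ℤ^d → ℝ by W^{x,y}(k) = ∑_{j∈ℤ^d} α^{x,y}(j) u(k−j). Then for all x, y, k ∈ ℤ^d one has W^{x,y}(k) ≥ α^{x,y}(k) · ū/2 > 0; in particular W^{x,y}(k) ≥ ū/4 for k ∈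 {x, y}. -/
noncomputable section

/-- The exponential weight `α^{x,y}(k) = (e^{-c|k-x|₁} + e^{-c|k-y|₁})/2`. -/
def alphaFn {d : ℕ} (c : ℝ) (x y k : Fin d → ℤ) : ℝ :=
  (1 / 2) * (Real.exp (-(c * (dist1 k x : ℝ))) + Real.exp (-(c * (dist1 k y : ℝ))))

/-- The exponentially averaged potential `W^{x,y}(k) = ∑_{j∈ℤ^d} α^{x,y}(j) u(k-j)`. -/
def Wfn {d : ℕ} (u : (Fin d → ℤ) → ℝ) (c : ℝ) (x y k : Fin d → ℤ) : ℝ :=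
  ∑' j : Fin d → ℤ, alphaFn c x y j * u (k - j)

theorem dist1_comm {d : ℕ} (a b : Fin d → ℤ) : dist1 a b = dist1 b a := by
  unfold dist1
  exact Finset.sum_congr rfl fun i _ => by omega

theorem dist1_triangle {d : ℕ} (a b z : Fin d → ℤ) : dist1 a z ≤ dist1 a b + dist1 b z := by
  unfold dist1
  rw [← Finset.sum_add_distrib]
  exact Finset.sum_le_sum fun i _ => by omega

theorem dist1_self {d : ℕ} (a : Fin d → ℤ) : dist1 a a = 0 := by
  simp [dist1]

theorem dist1_sub_self {d : ℕ} (a m : Fin d → ℤ) : dist1 (a - m) a = dist1 m 0 := by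
  unfold dist1
  exact Finset.sum_congr rfl fun i _ => by simp

theorem abs_exp_neg_sub_exp_neg_le {a b t : ℝ} (h : |a - b| ≤ t) :
    |Real.exp (-a) - Real.exp (-b)| ≤ Real.exp (-b) * (Real.exp t - 1) := by
  obtain ⟨h1, h2⟩ := abs_le.mp h
  have hb := Real.exp_pos (-b)
  have e1 : Real.exp (-a) ≤ Real.exp (-b) * Real.exp t := by
    rw [← Real.exp_add]
    exact Real.exp_le_exp.mpr (by linarith)
  have e2 : Real.exp (-b) * Real.exp (-t) ≤ Real.exp (-a) := by
    rw [← Real.exp_add]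
    exact Real.exp_le_exp.mpr (by linarith)
  have e3 : 2 ≤ Real.exp t + Real.exp (-t) := by
    linarith [Real.add_one_le_exp t, Real.add_one_le_exp (-t)]
  rw [abs_le]
  constructor <;> nlinarith

theorem abs_exp_dist1_sub_le {d : ℕ} {c : ℝ} (hc : 0 ≤ c) (x k l : Fin d → ℤ) {n : ℕ}
    (h : dist1 l k ≤ n) :
    |Real.exp (-(c * (dist1 l x : ℝ))) - Real.exp (-(c * (dist1 k x : ℝ)))| ≤
      Real.exp (-(c * (dist1 k x : ℝ))) * (Real.exp (c * n) - 1) := by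
  apply abs_exp_neg_sub_exp_neg_le
  have h1 : (dist1 l x : ℝ) ≤ n + dist1 k x := by
    exact_mod_cast (dist1_triangle l k x).trans (by omega)
  have h2 : (dist1 k x : ℝ) ≤ n + dist1 l x := by
    have := dist1_comm k l
    exact_mod_cast (dist1_triangle k l x).trans (by omega)
  rw [← mul_sub, abs_mul, abs_of_nonneg hc]
  gcongr
  rw [abs_le]
  constructor <;> linarith

theorem alphaFn_pos {d : ℕ} (c : ℝ) (x y k : Fin d → ℤ) : 0 < alphaFn c x y k := by
  unfold alphaFn
  positivity

theorem abs_alphaFn_sub_le {d : ℕ} {c : ℝ} (hc : 0 ≤ c) (x y k l : Fin d → ℤ) {n : ℕ}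
    (h : dist1 l k ≤ n) :
    |alphaFn c x y l - alphaFn c x y k| ≤ alphaFn c x y k * (Real.exp (c * n) - 1) := by
  have hx := abs_le.mp (abs_exp_dist1_sub_le hc x k l h)
  have hy := abs_le.mp (abs_exp_dist1_sub_le hc y k l h)
  unfold alphaFn
  rw [abs_le]
  constructor <;> linarith [hx.1, hx.2, hy.1, hy.2]

theorem Wfn_eq_sum {d : ℕ} (u : (Fin d → ℤ) → ℝ) (hu : (Function.support u).Finite) (c : ℝ)
    (x y k : Fin d → ℤ) :
    Wfn u c x y k = ∑ m ∈ hu.toFinset, alphaFn c x y (k - m) * u m := by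
  unfold Wfn
  rw [← (Equiv.subLeft k).tsum_eq]
  simp only [Equiv.subLeft_apply, sub_sub_cancel]
  refine tsum_eq_sum fun m hm => ?_
  have hm' : u m = 0 := by simpa using hm
  simp [hm']

theorem half_le_alphaFn {d : ℕ} (c : ℝ) {x y k : Fin d → ℤ} (h : k = x ∨ k = y) :
    1 / 2 ≤ alphaFn c x y k := by
  unfold alphaFn
  rcases h with rfl | rfl
  · simp only [dist1_self, Nat.cast_zero, mul_zero, neg_zero, Real.exp_zero]
    linarith [Real.exp_pos (-(c * (dist1 k y : ℝ)))]
  · simp only [dist1_self, Nat.cast_zero, mul_zero, neg_zero, Real.exp_zero]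
    linarith [Real.exp_pos (-(c * (dist1 k x : ℝ)))]

/-- **Pointwise lower bound for the exponentially averaged potential** (Lemma A.2). -/
theorem stmt_15 (d : ℕ) (hd : 1 ≤ d) (u : (Fin d → ℤ) → ℝ)
    (hufin : (Function.support u).Finite) (h0 : u 0 ≠ 0)
    (ubar : ℝ) (hubar : ubar = ∑' k : Fin d → ℤ, u k) (hubar_pos : 0 < ubar)
    (n : ℕ) (hn : 1 ≤ n)
    (hnmax : IsGreatest {m : ℕ | ∃ i, u i ≠ 0 ∧ ∃ j, u j ≠ 0 ∧ m = dist1 i j} n)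
    (c : ℝ) (hc : c = (1 / (n : ℝ)) *
      Real.log (1 + ubar / (2 * ∑' k : Fin d → ℤ, |u k|))) :
    ∀ x y k : Fin d → ℤ,
      (alphaFn c x y k * (ubar / 2) ≤ Wfn u c x y k ∧
        0 < alphaFn c x y k * (ubar / 2)) ∧
      ((k = x ∨ k = y) → ubar / 4 ≤ Wfn u c x y k) := by
  intro x y k
  have hsum : ubar = ∑ m ∈ hufin.toFinset, u m := by
    rw [hubar]
    exact tsum_eq_sum fun m hm => by simpa using hm
  have hnorm : ∑' k : Fin d → ℤ, |u k| = ∑ m ∈ hufin.toFinset, |u m| :=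
    tsum_eq_sum fun m hm => by simpa using hm
  rw [hnorm] at hc
  set S : ℝ := ∑ m ∈ hufin.toFinset, |u m| with hS
  have hSpos : 0 < S :=
    hubar_pos.trans_le (hsum.le.trans (Finset.sum_le_sum fun m _ => le_abs_self (u m)))
  have hq : 0 < ubar / (2 * S) := by positivity
  have hn0 : (0 : ℝ) < n := by exact_mod_cast hn
  have hc0 : 0 ≤ c := by
    rw [hc]
    exact mul_nonneg (by positivity) (Real.log_nonneg (by linarith))
  have hexp : Real.exp (c * n) - 1 = ubar / (2 * S) := by
    have : c * n = Real.log (1 + ubar / (2 * S)) := by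
      rw [hc]
      field_simp
    rw [this, Real.exp_log (by linarith)]
    ring
  have hα := alphaFn_pos c x y k
  have key : alphaFn c x y k * (ubar / 2) ≤ Wfn u c x y k := by
    rw [Wfn_eq_sum u hufin]
    calc alphaFn c x y k * (ubar / 2)
        = alphaFn c x y k * ubar - alphaFn c x y k * (ubar / (2 * S)) * S := by
          field_simp
          ring
      _ = ∑ m ∈ hufin.toFinset,
            (alphaFn c x y k * u m - alphaFn c x y k * (ubar / (2 * S)) * |u m|) := by
          rw [Finset.sum_sub_distrib, ← Finset.mul_sum, ← Finset.mul_sum, ← hsum, ← hS]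
      _ ≤ ∑ m ∈ hufin.toFinset, alphaFn c x y (k - m) * u m := by
          refine Finset.sum_le_sum fun m hm => ?_
          have hm' : u m ≠ 0 := by simpa using hm
          have hdist : dist1 (k - m) k ≤ n := by
            rw [dist1_sub_self]
            exact hnmax.2 ⟨m, hm', 0, h0, rfl⟩
          have hle := abs_alphaFn_sub_le hc0 x y k (k - m) hdist
          rw [hexp] at hle
          have hmul := mul_le_mul_of_nonneg_right hle (abs_nonneg (u m))
          rw [← abs_mul] at hmul
          linarith [(abs_le.mp hmul).1]
  refine ⟨⟨key, by positivity⟩, fun h => ?_⟩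
  have := half_le_alphaFn c h
  nlinarith

end
end

section
/- Quantitative avoidance of finitely many hyperplanes by a point of the unit cube (volume comparison argument of Figure 3.3): Let q ≥ 1, p ≥ 1 be integers and let v₁, …, v_p ∈ ℝ^q be nonzero vectors, with associated hyperplanes H_i = {α ∈ ℝ^q : ⟨α, v_i⟩ = 0}. Then there exists α ∈ [0,1]^q whose Euclidean distance to every H_i is at least 1/(2 p q^{(q−1)/2}); equivalently, |⟨α, v_i⟩| ≥ ‖v_i‖₂ / (2 p q^{(q−1)/2}) for every i ∈ {1,…,p}. -/
open scoped RealInnerProductSpace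

open MeasureTheory

/-- The part of the unit cube where a linear form is smaller than `r` has volume at most
`2 * r` divided by the absolute value of any nonzero coefficient of the form. -/
lemma volume_cube_inter_slab_le {n : ℕ} (w : Fin (n + 1) → ℝ) (j : Fin (n + 1)) (hj : w j ≠ 0)
    (r : ℝ) :
    volume {x : Fin (n + 1) → ℝ | x ∈ Set.Icc 0 1 ∧ |∑ k, x k * w k| < r} ≤
      ENNReal.ofReal (2 * (r / |w j|)) := by
  let l : (Fin n → ℝ) → ℝ := fun y => ∑ k, y k * w (j.succAbove k)
  let T : Set (ℝ × (Fin n → ℝ)) := {z | z.2 ∈ Set.Icc 0 1 ∧ |z.1 * w j + l z.2| < r}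
  have hT : MeasurableSet T := by
    have hm : Measurable fun z : ℝ × (Fin n → ℝ) => |z.1 * w j + l z.2| := by fun_prop
    exact (measurableSet_Icc.preimage measurable_snd).inter (measurableSet_lt hm measurable_const)
  have hsub : {x : Fin (n + 1) → ℝ | x ∈ Set.Icc 0 1 ∧ |∑ k, x k * w k| < r} ⊆
      MeasurableEquiv.piFinSuccAbove (fun _ => ℝ) j ⁻¹' T := by
    rintro x ⟨⟨h0, h1⟩, hr⟩
    rw [Fin.sum_univ_succAbove _ j] at hr
    exact ⟨⟨fun k => h0 (j.succAbove k), fun k => h1 (j.succAbove k)⟩, hr⟩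
  have hslice : ∀ y : Fin n → ℝ, volume ((fun t : ℝ => (t, y)) ⁻¹' T) ≤
      (Set.Icc (0 : Fin n → ℝ) 1).indicator (fun _ => ENNReal.ofReal (2 * (r / |w j|))) y := by
    intro y
    by_cases hy : y ∈ Set.Icc (0 : Fin n → ℝ) 1
    · rw [Set.indicator_of_mem hy, ← Real.volume_ball (-(l y / w j))]
      refine measure_mono fun t ht => ?_
      have ht' : |t * w j + l y| < r := ht.2
      rwa [Metric.mem_ball, Real.dist_eq, lt_div_iff₀ (abs_pos.2 hj), ← abs_mul, sub_neg_eq_add,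
        add_mul, div_mul_cancel₀ _ hj]
    · have hempty : (fun t : ℝ => (t, y)) ⁻¹' T = ∅ :=
        Set.eq_empty_of_forall_notMem fun t ht => hy ht.1
      simp [hempty]
  calc _ ≤ volume (MeasurableEquiv.piFinSuccAbove (fun _ => ℝ) j ⁻¹' T) := measure_mono hsub
    _ = volume T := (volume_preserving_piFinSuccAbove (fun _ => ℝ) j).measure_preimage_equiv T
    _ = ∫⁻ y, volume ((fun t : ℝ => (t, y)) ⁻¹' T) := Measure.prod_apply_symm hT
    _ ≤ ∫⁻ y, (Set.Icc (0 : Fin n → ℝ) 1).indicator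
          (fun _ => ENNReal.ofReal (2 * (r / |w j|))) y := lintegral_mono hslice
    _ = ENNReal.ofReal (2 * (r / |w j|)) := by
      rw [lintegral_indicator_const measurableSet_Icc, Real.volume_Icc_pi]
      simp

lemma EuclideanSpace.exists_norm_le_sqrt_card_mul_abs {ι : Type*} [Fintype ι] [Nonempty ι]
    (v : EuclideanSpace ℝ ι) : ∃ j, ‖v‖ ≤ √(Fintype.card ι) * |v j| := by
  obtain ⟨j, hj⟩ := Finite.exists_max fun k => |v k|
  refine ⟨j, ?_⟩
  rw [EuclideanSpace.norm_eq, ← Real.sqrt_sq (abs_nonneg (v j)), ← Real.sqrt_mul (by positivity)]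
  refine Real.sqrt_le_sqrt ?_
  calc ∑ k, ‖v k‖ ^ 2 ≤ ∑ _k : ι, |v j| ^ 2 :=
        Finset.sum_le_sum fun k _ => pow_le_pow_left₀ (norm_nonneg _) (hj k) 2
    _ = Fintype.card ι * |v j| ^ 2 := by simp

lemma exists_mem_cube_forall_mul_norm_le_of_lt {n p : ℕ}
    (v : Fin p → EuclideanSpace ℝ (Fin (n + 1))) (hv : ∀ i, v i ≠ 0) {c : ℝ}
    (hc : p * (2 * (c * √(n + 1 : ℕ))) < 1) :
    ∃ x ∈ Set.Icc (0 : Fin (n + 1) → ℝ) 1, ∀ i, c * ‖v i‖ ≤ |∑ k, x k * v i k| := by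
  by_contra! h
  rcases le_or_gt c 0 with hc0 | hc0
  · obtain ⟨i, hi⟩ := h 0 ⟨le_rfl, zero_le_one⟩
    exact absurd hi (not_lt.2 ((mul_nonpos_of_nonpos_of_nonneg hc0 (norm_nonneg _)).trans
      (abs_nonneg _)))
  let B : Fin p → Set (Fin (n + 1) → ℝ) := fun i =>
    {x | x ∈ Set.Icc 0 1 ∧ |∑ k, x k * v i k| < c * ‖v i‖}
  have hcover : Set.Icc (0 : Fin (n + 1) → ℝ) 1 ⊆ ⋃ i, B i := fun x hx =>
    let ⟨i, hi⟩ := h x hx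
    Set.mem_iUnion.2 ⟨i, hx, hi⟩
  have hB : ∀ i, volume (B i) ≤ ENNReal.ofReal (2 * (c * √(n + 1 : ℕ))) := by
    intro i
    obtain ⟨j, hj⟩ := EuclideanSpace.exists_norm_le_sqrt_card_mul_abs (v i)
    rw [Fintype.card_fin] at hj
    have hvj : v i j ≠ 0 := by
      intro h0
      rw [h0, abs_zero, mul_zero] at hj
      exact hv i (norm_le_zero_iff.1 hj)
    refine (volume_cube_inter_slab_le (fun k => v i k) j hvj _).trans
      (ENNReal.ofReal_le_ofReal ?_)
    rw [mul_le_mul_iff_right₀ two_pos, div_le_iff₀ (abs_pos.2 hvj), mul_assoc]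
    exact mul_le_mul_of_nonneg_left hj hc0.le
  have hvol : (1 : ENNReal) ≤ ENNReal.ofReal (p * (2 * (c * √(n + 1 : ℕ)))) :=
    calc (1 : ENNReal) = volume (Set.Icc (0 : Fin (n + 1) → ℝ) 1) := by
          rw [Real.volume_Icc_pi]; simp
      _ ≤ ∑ i, volume (B i) := (measure_mono hcover).trans (measure_iUnion_fintype_le _ _)
      _ ≤ ∑ _i : Fin p, ENNReal.ofReal (2 * (c * √(n + 1 : ℕ))) :=
          Finset.sum_le_sum fun i _ => hB i
      _ = ENNReal.ofReal (p * (2 * (c * √(n + 1 : ℕ)))) := by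
          rw [ENNReal.ofReal_mul (Nat.cast_nonneg p)]; simp
  exact absurd (ENNReal.one_le_ofReal.1 hvol) (not_le.2 hc)

lemma exists_mem_cube_forall_mul_norm_le {n p : ℕ} (hp : 1 ≤ p)
    (v : Fin p → EuclideanSpace ℝ (Fin (n + 1))) (hv : ∀ i, v i ≠ 0) {c : ℝ}
    (hc : p * (2 * (c * √(n + 1 : ℕ))) ≤ 1) :
    ∃ x ∈ Set.Icc (0 : Fin (n + 1) → ℝ) 1, ∀ i, c * ‖v i‖ ≤ |∑ k, x k * v i k| := by
  have hne : (Finset.univ : Finset (Fin p)).Nonempty := ⟨⟨0, hp⟩, Finset.mem_univ _⟩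
  let f : (Fin (n + 1) → ℝ) → ℝ := fun x =>
    Finset.univ.inf' hne fun i => |∑ k, x k * v i k| / ‖v i‖
  have hf : Continuous f := by
    refine Continuous.finset_inf'_apply hne fun i _ => ?_
    fun_prop
  obtain ⟨x, hx, hmax⟩ := (isCompact_Icc (a := (0 : Fin (n + 1) → ℝ)) (b := 1)).exists_isMaxOn
    ⟨0, le_rfl, zero_le_one⟩ hf.continuousOn
  have hle : c ≤ f x := by
    refine le_of_forall_lt_imp_le_of_dense fun c' hc' => ?_
    have hp' : (0 : ℝ) < p := by exact_mod_cast hp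
    have hs : 0 < √((n + 1 : ℕ) : ℝ) := Real.sqrt_pos.2 (by positivity)
    obtain ⟨y, hy, hyv⟩ := exists_mem_cube_forall_mul_norm_le_of_lt v hv
      (lt_of_lt_of_le (by gcongr) hc : p * (2 * (c' * √(n + 1 : ℕ))) < 1)
    exact (Finset.le_inf' hne _ fun i _ =>
      (le_div_iff₀ (norm_pos_iff.2 (hv i))).2 (hyv i)).trans (hmax hy)
  exact ⟨x, hx, fun i => (le_div_iff₀ (norm_pos_iff.2 (hv i))).1
    (hle.trans (Finset.inf'_le _ (Finset.mem_univ i)))⟩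

lemma le_infDist_of_mul_norm_le_abs_inner {E : Type*} [NormedAddCommGroup E]
    [InnerProductSpace ℝ E] {a v : E} (hv : v ≠ 0) {c : ℝ} (h : c * ‖v‖ ≤ |⟪a, v⟫|) :
    c ≤ Metric.infDist a {b : E | ⟪b, v⟫ = 0} := by
  have hne : {b : E | ⟪b, v⟫ = 0}.Nonempty := ⟨0, by simp⟩
  refine (Metric.le_infDist hne).2 fun b hb => ?_
  have hb' : ⟪a, v⟫ = ⟪a - b, v⟫ := by
    rw [inner_sub_left, show ⟪b, v⟫ = 0 from hb, sub_zero]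
  rw [hb'] at h
  rw [dist_eq_norm]
  exact le_of_mul_le_mul_right (h.trans (abs_real_inner_le_norm _ _)) (norm_pos_iff.2 hv)

lemma sqrt_natCast_le_rpow_half_pred {q : ℕ} (hq : 1 ≤ q) :
    √(q : ℝ) ≤ (q : ℝ) ^ (((q : ℝ) - 1) / 2) := by
  rcases hq.eq_or_lt with rfl | hq2
  · simp
  · have h2 : (2 : ℝ) ≤ q := by exact_mod_cast hq2
    rw [Real.sqrt_eq_rpow]
    exact Real.rpow_le_rpow_of_exponent_le (by linarith) (by linarith)

/-- **Quantitative avoidance of finitely many hyperplanes by a point of the unit cube**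
(volume comparison argument of Figure 3.3): given nonzero vectors `v₁, …, v_p ∈ ℝ^q`, there is
a point `α` of the unit cube `[0,1]^q` whose Euclidean distance to each hyperplane
`H_i = {β : ⟨β, v_i⟩ = 0}` is at least `1/(2 p q^{(q-1)/2})`; equivalently
`|⟨α, v_i⟩| ≥ ‖v_i‖₂ / (2 p q^{(q-1)/2})` for every `i`. -/
theorem stmt_19 (q p : ℕ) (hq : 1 ≤ q) (hp : 1 ≤ p)
    (v : Fin p → EuclideanSpace ℝ (Fin q)) (hv : ∀ i, v i ≠ 0) :
    ∃ α : EuclideanSpace ℝ (Fin q), (∀ j, α j ∈ Set.Icc (0 : ℝ) 1) ∧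
      ∀ i : Fin p,
        (1 : ℝ) / (2 * p * (q : ℝ) ^ (((q : ℝ) - 1) / 2)) ≤
          Metric.infDist α {β : EuclideanSpace ℝ (Fin q) | ⟪β, v i⟫ = 0} ∧
        ‖v i‖ / (2 * p * (q : ℝ) ^ (((q : ℝ) - 1) / 2)) ≤ |⟪α, v i⟫| := by
  obtain ⟨n, rfl⟩ := Nat.exists_eq_add_of_le' hq
  have hp' : (0 : ℝ) < p := by exact_mod_cast hp
  have hD := sqrt_natCast_le_rpow_half_pred hq
  set D : ℝ := ((n + 1 : ℕ) : ℝ) ^ ((((n + 1 : ℕ) : ℝ) - 1) / 2)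
  have hD0 : 0 < D := Real.rpow_pos_of_pos (by positivity) _
  have hc : p * (2 * (1 / (2 * p * D) * √(n + 1 : ℕ))) ≤ 1 := by
    have heq : p * (2 * (1 / (2 * p * D) * √(n + 1 : ℕ))) = √(n + 1 : ℕ) / D := by
      field_simp
    rw [heq]
    exact (div_le_one hD0).2 hD
  obtain ⟨x, hx, hxv⟩ := exists_mem_cube_forall_mul_norm_le hp v hv hc
  refine ⟨WithLp.toLp 2 x, fun j => ⟨hx.1 j, hx.2 j⟩, fun i => ?_⟩
  have hi : 1 / (2 * p * D) * ‖v i‖ ≤ |⟪WithLp.toLp 2 x, v i⟫| := by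
    simpa [PiLp.inner_apply, mul_comm] using hxv i
  exact ⟨le_infDist_of_mul_norm_le_abs_inner (hv i) hi, by rwa [one_div_mul_eq_div] at hi⟩
end
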